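/- arXiv:1311.5750 — 2 statements merged into one kernel-verified Lean document; each statement's English description precedes it below -/
import Mathlib

section
/- Let Σ_n be a real symmetric p×p matrix and define L(Ω) = −log det Ω + ⟨Σ_n, Ω⟩ (with ⟨A,B⟩ = Tr(AᵀB)) on symmetric positive definite matrices, so that ∇L(Ω) = Σ_n − Ω^{−1}. Let 0 < α ≤ β and let Ω, Ω' be symmetric matrices with αI ⪯ Ω ⪯ βI and αI ⪯ Ω' ⪯ βI. Then for every ζ with 0 < ζ < 2α⁴/β², ‖Ω − Ω' − ζ(∇L(Ω) − ∇L(Ω'))‖_F ≤ ρ·‖Ω − Ω'‖_F, where ρ = √(1 − 2ζβ^{−2} + ζ²α^{−4}) and ‖·‖_F is the Frobenius norm; equivalently L satisfies condition C(s,ζ,ρ) on this cone for any sparsity level s. -/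
open Matrix

/-- The Frobenius norm of a real square matrix. -/
noncomputable def frobNorm {p : ℕ} (A : Matrix (Fin p) (Fin p) ℝ) : ℝ :=
  Real.sqrt (∑ i, ∑ j, (A i j) ^ 2)

namespace Matrix.PosSemidef

variable {n : Type*} [Fintype n]

theorem trace_mul_nonneg {P Q : Matrix n n ℝ} (hP : P.PosSemidef) (hQ : Q.PosSemidef) :
    0 ≤ (P * Q).trace := by
  classical
  obtain ⟨m, v, rfl⟩ := posSemidef_iff_eq_sum_vecMulVec.mp hQ
  rw [Finset.mul_sum, trace_sum]
  refine Finset.sum_nonneg fun i _ => ?_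
  rw [mul_vecMulVec, trace_vecMulVec, dotProduct_comm]
  exact hP.dotProduct_mulVec_nonneg (v i)

theorem trace_mul_mul_mul_nonneg {P Q D : Matrix n n ℝ} (hP : P.PosSemidef)
    (hQ : Q.PosSemidef) (hD : D.IsSymm) : 0 ≤ (D * P * D * Q).trace := by
  have h := hP.mul_mul_conjTranspose_same D
  rw [conjTranspose_eq_transpose_of_trivial, hD.eq] at h
  exact h.trace_mul_nonneg hQ

variable [DecidableEq n]

theorem trace_mul_mul_mul_ge {A B D : Matrix n n ℝ} {c : ℝ} (hc : 0 ≤ c)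
    (hA : (A - c • 1).PosSemidef) (hB : (B - c • 1).PosSemidef) (hD : D.IsSymm) :
    c ^ 2 * (D * D).trace ≤ (D * A * D * B).trace := by
  have h1 := hA.trace_mul_mul_mul_nonneg hB hD
  have h2 := hA.trace_mul_mul_mul_nonneg PosSemidef.one hD
  have h3 := PosSemidef.one.trace_mul_mul_mul_nonneg hB hD
  have h4 : (D * D * A).trace = (D * A * D).trace := by
    rw [Matrix.mul_assoc, trace_mul_comm]
  simp only [Matrix.mul_sub, Matrix.sub_mul, Matrix.mul_smul, Matrix.smul_mul, Matrix.mul_one,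
    trace_sub, trace_smul, smul_eq_mul] at h1 h2 h3
  nlinarith [mul_nonneg hc h2, mul_nonneg hc h3]

theorem trace_mul_mul_mul_le {A B D : Matrix n n ℝ} {c : ℝ} (hc : 0 ≤ c)
    (hA : (c • 1 - A).PosSemidef) (hB : (c • 1 - B).PosSemidef) (hB0 : B.PosSemidef)
    (hD : D.IsSymm) : (D * A * D * B).trace ≤ c ^ 2 * (D * D).trace := by
  have h1 := hA.trace_mul_mul_mul_nonneg hB0 hD
  have h3 := PosSemidef.one.trace_mul_mul_mul_nonneg hB hD
  simp only [Matrix.mul_sub, Matrix.sub_mul, Matrix.mul_smul, Matrix.smul_mul, Matrix.mul_one,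
    trace_sub, trace_smul, smul_eq_mul] at h1 h3
  nlinarith [mul_nonneg hc h3]

end Matrix.PosSemidef

section Inverse

variable {n : Type*} [DecidableEq n] {W : Matrix n n ℝ} {α β : ℝ}

theorem Matrix.posDef_of_sub_smul_one_posSemidef (hα : 0 < α)
    (h : (W - α • 1).PosSemidef) : W.PosDef := by
  have := (PosDef.one.smul hα).posSemidef_add h
  simpa using this

variable [Fintype n]

theorem Matrix.PosSemidef.smul_one_sub_inv_sq (hα : 0 < α) (h : (W - α • 1).PosSemidef) :
    ((α ^ 2)⁻¹ • 1 - W⁻¹ * W⁻¹).PosSemidef := by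
  have hW := posDef_of_sub_smul_one_posSemidef hα h
  have hu := (isUnit_iff_isUnit_det W).mp hW.isUnit
  have hsq : (W * W - α ^ 2 • 1).PosSemidef := by
    have := (h.pow 2).add (h.smul (by positivity : 0 ≤ 2 * α))
    convert this using 1
    simp only [pow_two, Matrix.mul_sub, Matrix.sub_mul, Matrix.mul_smul, Matrix.smul_mul,
      Matrix.mul_one, Matrix.one_mul, smul_sub, smul_smul]
    module
  have key := (hsq.mul_mul_conjTranspose_same W⁻¹).smul (by positivity : 0 ≤ (α ^ 2)⁻¹)
  rw [hW.inv.isHermitian.eq] at key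
  convert key using 1
  have e : W⁻¹ * (W * W) * W⁻¹ = 1 := by
    rw [← Matrix.mul_assoc, nonsing_inv_mul _ hu, Matrix.one_mul, mul_nonsing_inv _ hu]
  rw [Matrix.mul_sub, Matrix.sub_mul, e, Matrix.mul_smul, Matrix.smul_mul, Matrix.mul_one,
    smul_sub, smul_smul, inv_mul_cancel₀ (by positivity), one_smul]

theorem Matrix.PosDef.inv_sub_smul_one (hW : W.PosDef) (hβ : 0 < β)
    (h : (β • 1 - W).PosSemidef) : (W⁻¹ - β⁻¹ • 1).PosSemidef := by
  have hu := (isUnit_iff_isUnit_det W).mp hW.isUnit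
  have hprod : (β • W - W * W).PosSemidef := by
    have k1 := h.mul_mul_conjTranspose_same W
    have k2 := hW.posSemidef.mul_mul_conjTranspose_same (β • 1 - W)
    rw [hW.isHermitian.eq] at k1
    rw [h.isHermitian.eq] at k2
    have k := (k1.add k2).smul (by positivity : 0 ≤ β⁻¹)
    convert k using 1
    have : β • (β • W - W * W) = W * (β • 1 - W) * W + (β • 1 - W) * W * (β • 1 - W) := by
      simp only [Matrix.mul_sub, Matrix.sub_mul, Matrix.mul_smul, Matrix.smul_mul,
        Matrix.mul_one, Matrix.one_mul, smul_sub, smul_smul]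
      module
    rw [← this, smul_smul, inv_mul_cancel₀ hβ.ne', one_smul]
  have key := (hprod.mul_mul_conjTranspose_same W⁻¹).smul (by positivity : 0 ≤ β⁻¹)
  rw [hW.inv.isHermitian.eq] at key
  convert key using 1
  have e : W⁻¹ * (W * W) * W⁻¹ = 1 := by
    rw [← Matrix.mul_assoc, nonsing_inv_mul _ hu, Matrix.one_mul, mul_nonsing_inv _ hu]
  rw [Matrix.mul_sub, Matrix.sub_mul, e, Matrix.mul_smul, Matrix.smul_mul,
    nonsing_inv_mul _ hu, Matrix.one_mul, smul_sub, smul_smul, inv_mul_cancel₀ hβ.ne', one_smul]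

end Inverse

theorem frobNorm_eq_sqrt_trace {p : ℕ} (A : Matrix (Fin p) (Fin p) ℝ) :
    frobNorm A = Real.sqrt (A * Aᵀ).trace := by
  simp [frobNorm, trace, mul_apply, pow_two]

theorem logdet_condC {p : ℕ} (Sn : Matrix (Fin p) (Fin p) ℝ) (hSn : Sn.IsSymm)
    (α β : ℝ) (hα : 0 < α) (hαβ : α ≤ β)
    (Ω Ω' : Matrix (Fin p) (Fin p) ℝ) (hΩs : Ω.IsSymm) (hΩ's : Ω'.IsSymm)
    (h1 : (Ω - α • 1).PosSemidef) (h2 : ((β • 1 : Matrix (Fin p) (Fin p) ℝ) - Ω).PosSemidef)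
    (h1' : (Ω' - α • 1).PosSemidef) (h2' : ((β • 1 : Matrix (Fin p) (Fin p) ℝ) - Ω').PosSemidef) :
    ∀ ζ : ℝ, 0 < ζ → ζ < 2 * α ^ 4 / β ^ 2 →
      frobNorm (Ω - Ω' - ζ • ((Sn - Ω⁻¹) - (Sn - Ω'⁻¹))) ≤
        Real.sqrt (1 - 2 * ζ * (β ^ 2)⁻¹ + ζ ^ 2 * (α ^ 4)⁻¹) * frobNorm (Ω - Ω') := by
  intro ζ hζ _
  have hβ : 0 < β := hα.trans_le hαβ
  have hP := posDef_of_sub_smul_one_posSemidef hα h1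
  have hP' := posDef_of_sub_smul_one_posSemidef hα h1'
  have hu := (isUnit_iff_isUnit_det Ω).mp hP.isUnit
  have hu' := (isUnit_iff_isUnit_det Ω').mp hP'.isUnit
  have hD : (Ω - Ω').IsSymm := hΩs.sub hΩ's
  have hG : (Sn - Ω⁻¹) - (Sn - Ω'⁻¹) = Ω⁻¹ * (Ω - Ω') * Ω'⁻¹ := by
    rw [Matrix.mul_sub, Matrix.sub_mul, nonsing_inv_mul _ hu, Matrix.mul_assoc Ω⁻¹ Ω',
      mul_nonsing_inv _ hu', Matrix.one_mul, Matrix.mul_one]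
    abel
  have hAs : (Ω⁻¹)ᵀ = Ω⁻¹ := by rw [transpose_nonsing_inv, hΩs.eq]
  have hBs : (Ω'⁻¹)ᵀ = Ω'⁻¹ := by rw [transpose_nonsing_inv, hΩ's.eq]
  have hlow := (hP.inv_sub_smul_one hβ h2).trace_mul_mul_mul_ge (by positivity)
    (hP'.inv_sub_smul_one hβ h2') hD
  have hB0 : (Ω'⁻¹ * Ω'⁻¹).PosSemidef := by
    simpa [pow_two] using hP'.inv.posSemidef.pow 2
  have hup := h1.smul_one_sub_inv_sq hα |>.trace_mul_mul_mul_le (by positivity)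
    (h1'.smul_one_sub_inv_sq hα) hB0 hD
  rw [hG, frobNorm_eq_sqrt_trace, frobNorm_eq_sqrt_trace]
  generalize Ω⁻¹ = A at *
  generalize Ω'⁻¹ = B at *
  generalize Ω - Ω' = D at *
  have h0 : 0 ≤ (D * Dᵀ).trace := by
    simpa using (posSemidef_self_mul_conjTranspose D).trace_nonneg
  rw [← Real.sqrt_mul' _ h0]
  apply Real.sqrt_le_sqrt
  simp only [Matrix.mul_assoc] at hlow hup
  have e1 : (D * (B * (D * A))).trace = (D * (A * (D * B))).trace := by
    rw [← Matrix.mul_assoc, trace_mul_comm, Matrix.mul_assoc]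
  have e2 : (A * (D * (B * D))).trace = (D * (A * (D * B))).trace := by
    rw [trace_mul_comm, ← e1]
    simp only [Matrix.mul_assoc]
  have e3 : (A * (D * (B * (B * (D * A))))).trace
      = (D * (A * (A * (D * (B * B))))).trace := by
    rw [trace_mul_comm]
    have := trace_mul_comm (D * (B * B)) (D * (A * A))
    simpa only [Matrix.mul_assoc] using this
  simp only [transpose_sub, transpose_smul, transpose_mul, hD.eq, hAs, hBs, Matrix.mul_sub,
    Matrix.sub_mul, Matrix.mul_smul, Matrix.smul_mul, trace_sub, trace_smul, smul_eq_mul,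
    Matrix.mul_assoc, e1, e2, e3]
  have i1 : (β⁻¹) ^ 2 = (β ^ 2)⁻¹ := inv_pow β 2
  have i2 : ((α ^ 2)⁻¹) ^ 2 = (α ^ 4)⁻¹ := by rw [inv_pow, ← pow_mul]
  rw [i1] at hlow
  rw [i2] at hup
  nlinarith [mul_le_mul_of_nonneg_left hlow hζ.le, mul_le_mul_of_nonneg_left hup (sq_nonneg ζ)]
end

section
/- Let M be a real symmetric p×p matrix with eigendecomposition M = V·diag(λ_1,…,λ_p)·Vᵀ (V orthogonal), let ρ > 0 and 0 < α ≤ β. Define λ̃_j = min{β, max{α, (λ_j + √(λ_j² + 4/ρ))/2}} and Ω* = V·diag(λ̃_1,…,λ̃_p)·Vᵀ. Then Ω* minimizes the function Ω ↦ (1/2)‖Ω − M‖_F² − (1/ρ)·log det Ω over all symmetric matrices Ω with αI ⪯ Ω ⪯ βI; i.e., αI ⪯ Ω* ⪯ βI and for every symmetric Ω with αI ⪯ Ω ⪯ βI one has (1/2)‖Ω* − M‖_F² − (1/ρ)log det Ω* ≤ (1/2)‖Ω − M‖_F² − (1/ρ)log det Ω. -/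
open Matrix

/-- The squared Frobenius norm is the sum of the squared entries. -/
theorem frobNorm_sq {p : ℕ} (A : Matrix (Fin p) (Fin p) ℝ) :
    frobNorm A ^ 2 = ∑ i, ∑ j, (A i j) ^ 2 :=
  Real.sq_sqrt (Finset.sum_nonneg fun _ _ => Finset.sum_nonneg fun _ _ => sq_nonneg _)

theorem frobNorm_sq_eq_trace {p : ℕ} (A : Matrix (Fin p) (Fin p) ℝ) :
    frobNorm A ^ 2 = (A * Aᵀ).trace := by
  rw [frobNorm_sq]
  simp [Matrix.trace, Matrix.mul_apply, sq]

/-- The Frobenius norm is invariant under orthogonal conjugation. -/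
theorem frobNorm_sq_conj {p : ℕ} {V : Matrix (Fin p) (Fin p) ℝ} (hV : Vᵀ * V = 1)
    (A : Matrix (Fin p) (Fin p) ℝ) : frobNorm (V * A * Vᵀ) ^ 2 = frobNorm A ^ 2 := by
  rw [frobNorm_sq_eq_trace, frobNorm_sq_eq_trace]
  have h : V * A * Vᵀ * (V * A * Vᵀ)ᵀ = V * (A * Aᵀ * Vᵀ) := by
    calc V * A * Vᵀ * (V * A * Vᵀ)ᵀ = V * A * (Vᵀ * V) * (Aᵀ * Vᵀ) := by
          simp only [Matrix.transpose_mul, Matrix.transpose_transpose, Matrix.mul_assoc]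
      _ = V * (A * Aᵀ * Vᵀ) := by rw [hV]; simp only [Matrix.mul_one, Matrix.mul_assoc]
  rw [h, Matrix.trace_mul_comm, Matrix.mul_assoc, hV, Matrix.mul_one]

theorem sum_diag_sq_le_frobNorm_sq {p : ℕ} (A : Matrix (Fin p) (Fin p) ℝ) :
    ∑ i, (A i i) ^ 2 ≤ frobNorm A ^ 2 := by
  rw [frobNorm_sq]
  exact Finset.sum_le_sum fun i _ =>
    Finset.single_le_sum (f := fun j => (A i j) ^ 2) (fun _ _ => sq_nonneg _) (Finset.mem_univ i)

theorem frobNorm_sq_diagonal {p : ℕ} (d : Fin p → ℝ) :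
    frobNorm (Matrix.diagonal d) ^ 2 = ∑ i, (d i) ^ 2 := by
  rw [frobNorm_sq_eq_trace]
  simp [Matrix.trace, sq]

theorem log_det_le_trace_sub_card {n : Type*} [Fintype n] [DecidableEq n] {B : Matrix n n ℝ}
    (hB : B.PosDef) : Real.log B.det ≤ B.trace - Fintype.card n := by
  rw [hB.isHermitian.det_eq_prod_eigenvalues, hB.isHermitian.trace_eq_sum_eigenvalues]
  simp only [RCLike.ofReal_real_eq_id, id_eq]
  rw [Real.log_prod fun i _ => (hB.eigenvalues_pos i).ne']
  calc ∑ i, Real.log (hB.isHermitian.eigenvalues i)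
      ≤ ∑ i, (hB.isHermitian.eigenvalues i - 1) :=
        Finset.sum_le_sum fun i _ => Real.log_le_sub_one_of_pos (hB.eigenvalues_pos i)
    _ = _ := by simp [Finset.sum_sub_distrib]

/-- Hadamard's inequality for positive definite matrices, in logarithmic form. -/
theorem log_det_le_sum_log_diag {n : Type*} [Fintype n] [DecidableEq n] {Y : Matrix n n ℝ}
    (hY : Y.PosDef) : Real.log Y.det ≤ ∑ i, Real.log (Y i i) := by
  have hpos : ∀ i, 0 < Y i i := fun _ => hY.diag_pos
  set d : n → ℝ := fun i => (Real.sqrt (Y i i))⁻¹ with hd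
  have hdpos : ∀ i, 0 < d i := fun i => inv_pos.2 (Real.sqrt_pos.2 (hpos i))
  have hdsq : ∀ i, d i * d i = (Y i i)⁻¹ := fun i => by
    rw [hd]
    simp only
    rw [← mul_inv, Real.mul_self_sqrt (hpos i).le]
  have hunit : IsUnit (Matrix.diagonal d) :=
    (Matrix.isUnit_iff_isUnit_det _).2 (by
      rw [Matrix.det_diagonal]
      exact (Finset.prod_pos fun i _ => hdpos i).ne'.isUnit)
  have hB : (Matrix.diagonal d * Y * Matrix.diagonal d).PosDef := by
    have := hY.conjTranspose_mul_mul_same (B := Matrix.diagonal d)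
      (Matrix.mulVec_injective_of_isUnit hunit)
    simpa [Matrix.diagonal_conjTranspose] using this
  have htr : (Matrix.diagonal d * Y * Matrix.diagonal d).trace = Fintype.card n := by
    have h : ∀ i, d i * Y i i * d i = 1 := fun i => by
      rw [mul_right_comm, hdsq, inv_mul_cancel₀ (hpos i).ne']
    simp [Matrix.trace, Matrix.mul_diagonal, Matrix.diagonal_mul, h]
  have hdet : (Matrix.diagonal d * Y * Matrix.diagonal d).det = Y.det * ∏ i, (Y i i)⁻¹ := by
    rw [Matrix.det_mul, Matrix.det_mul, Matrix.det_diagonal, mul_comm (∏ i, d i), mul_assoc,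
      ← Finset.prod_mul_distrib]
    simp only [hdsq]
  have h := log_det_le_trace_sub_card hB
  rw [htr, hdet, Real.log_mul hY.det_pos.ne'
    (Finset.prod_pos fun i _ => inv_pos.2 (hpos i)).ne',
    Real.log_prod fun i _ => (inv_pos.2 (hpos i)).ne'] at h
  simp only [Real.log_inv, Finset.sum_neg_distrib] at h
  linarith

/-- The scalar problem: clamping the unconstrained minimizer of
`y ↦ (y - l) ^ 2 / 2 - log y / ρ` to `[α, β]` gives the constrained minimizer. -/
theorem clamp_minimizes_sq_sub_log {l ρ α β t y : ℝ} (hρ : 0 < ρ) (hα : 0 < α) (hαβ : α ≤ β)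
    (ht : t = min β (max α ((l + Real.sqrt (l ^ 2 + 4 / ρ)) / 2))) (hy : α ≤ y) (hy' : y ≤ β) :
    1 / 2 * (t - l) ^ 2 - (1 / ρ) * Real.log t ≤ 1 / 2 * (y - l) ^ 2 - (1 / ρ) * Real.log y := by
  set r := (l + Real.sqrt (l ^ 2 + 4 / ρ)) / 2 with hr
  have hρ4 : 0 < 4 / ρ := by positivity
  have hs : Real.sqrt (l ^ 2 + 4 / ρ) ^ 2 = l ^ 2 + 4 / ρ := Real.sq_sqrt (by positivity)
  have hsl : |l| < Real.sqrt (l ^ 2 + 4 / ρ) := by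
    rw [← Real.sqrt_sq_eq_abs]
    exact Real.sqrt_lt_sqrt (sq_nonneg l) (by linarith)
  have hrl : 0 < r - l := by rw [hr]; linarith [le_abs_self l]
  have hroot : r * (r - l) = 1 / ρ := by
    have : r * (r - l) = (Real.sqrt (l ^ 2 + 4 / ρ) ^ 2 - l ^ 2) / 4 := by rw [hr]; ring
    rw [this, hs]
    ring
  have htpos : 0 < t := ht ▸ lt_min (hα.trans_le hαβ) (hα.trans_le (le_max_left _ _))
  have hypos : 0 < y := hα.trans_le hy
  have hclamp : 0 ≤ (y - t) * (t - r) := by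
    rcases le_total r α with h | h
    · rw [max_eq_left h, min_eq_right hαβ] at ht
      exact mul_nonneg (by linarith) (by linarith)
    · rw [max_eq_right h] at ht
      rcases le_total r β with h' | h'
      · rw [min_eq_right h'] at ht
        simp [ht]
      · rw [min_eq_left h'] at ht
        exact mul_nonneg_of_nonpos_of_nonpos (by linarith) (by linarith)
  have hlog : Real.log y - Real.log t ≤ y / t - 1 := by
    rw [← Real.log_div hypos.ne' htpos.ne']
    exact Real.log_le_sub_one_of_pos (div_pos hypos htpos)
  have hlog' := mul_le_mul_of_nonneg_left hlog (one_div_pos.2 hρ).le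
  have hkey : 1 / 2 * (y - l) ^ 2 - 1 / 2 * (t - l) ^ 2 - 1 / ρ * (y / t - 1) =
      1 / 2 * (y - t) ^ 2 + (y - t) * (t - r) * (t + (r - l)) / t := by
    rw [← hroot]
    field_simp
    ring
  have hnonneg : 0 ≤ (y - t) * (t - r) * (t + (r - l)) / t :=
    div_nonneg (mul_nonneg hclamp (by linarith)) htpos.le
  nlinarith [sq_nonneg (y - t)]

theorem posSemidef_conj_diagonal {p : ℕ} (V : Matrix (Fin p) (Fin p) ℝ) {d : Fin p → ℝ}
    (hd : ∀ i, 0 ≤ d i) : (V * Matrix.diagonal d * Vᵀ).PosSemidef := by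
  simpa using (Matrix.PosSemidef.diagonal (d := d) hd).mul_mul_conjTranspose_same V

theorem adm_log_det_projection {p : ℕ} (M V : Matrix (Fin p) (Fin p) ℝ)
    (lam : Fin p → ℝ) (ρ α β : ℝ) (hρ : 0 < ρ) (hα : 0 < α) (hαβ : α ≤ β)
    (hV : V * Vᵀ = 1) (hV' : Vᵀ * V = 1)
    (hM : M = V * Matrix.diagonal lam * Vᵀ)
    (lamT : Fin p → ℝ)
    (hlamT : ∀ j, lamT j = min β (max α ((lam j + Real.sqrt ((lam j) ^ 2 + 4 / ρ)) / 2)))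
    (Ωstar : Matrix (Fin p) (Fin p) ℝ) (hΩstar : Ωstar = V * Matrix.diagonal lamT * Vᵀ) :
    (Ωstar - α • 1).PosSemidef ∧ ((β • 1 : Matrix (Fin p) (Fin p) ℝ) - Ωstar).PosSemidef ∧
      ∀ Ω : Matrix (Fin p) (Fin p) ℝ, Ω.IsSymm →
        (Ω - α • 1).PosSemidef → ((β • 1 : Matrix (Fin p) (Fin p) ℝ) - Ω).PosSemidef →
          1 / 2 * frobNorm (Ωstar - M) ^ 2 - (1 / ρ) * Real.log Ωstar.det ≤
            1 / 2 * frobNorm (Ω - M) ^ 2 - (1 / ρ) * Real.log Ω.det := by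
  have hα_le : ∀ j, α ≤ lamT j := fun j => hlamT j ▸ le_min hαβ (le_max_left _ _)
  have hle_β : ∀ j, lamT j ≤ β := fun j => hlamT j ▸ min_le_left _ _
  have hconj : ∀ c : ℝ, (c • 1 : Matrix (Fin p) (Fin p) ℝ) =
      V * Matrix.diagonal (fun _ => c) * Vᵀ := fun c => by
    rw [← Matrix.smul_one_eq_diagonal, Matrix.mul_smul, Matrix.mul_one, Matrix.smul_mul, hV]
  refine ⟨?_, ?_, fun Ω _ hΩα hΩβ => ?_⟩
  · rw [hΩstar, hconj, ← Matrix.sub_mul, ← Matrix.mul_sub, Matrix.diagonal_sub]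
    exact posSemidef_conj_diagonal V fun i => sub_nonneg.2 (hα_le i)
  · rw [hΩstar, hconj, ← Matrix.sub_mul, ← Matrix.mul_sub, Matrix.diagonal_sub]
    exact posSemidef_conj_diagonal V fun i => sub_nonneg.2 (hle_β i)
  obtain ⟨Y, hYdef⟩ : ∃ Y, Y = Vᵀ * Ω * V := ⟨_, rfl⟩
  have hΩ : Ω = V * Y * Vᵀ := by
    calc Ω = (V * Vᵀ) * Ω * (V * Vᵀ) := by rw [hV, Matrix.one_mul, Matrix.mul_one]
      _ = V * Y * Vᵀ := by rw [hYdef]; simp only [Matrix.mul_assoc]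
  have hYα : (Y - α • 1).PosSemidef := by
    have h : Y - α • 1 = Vᵀ * (Ω - α • 1) * V := by
      rw [Matrix.mul_sub, Matrix.sub_mul, ← hYdef, Matrix.mul_smul, Matrix.mul_one,
        Matrix.smul_mul, hV']
    rw [h]
    simpa using hΩα.conjTranspose_mul_mul_same V
  have hYβ : ((β • 1 : Matrix (Fin p) (Fin p) ℝ) - Y).PosSemidef := by
    have h : (β • 1 : Matrix (Fin p) (Fin p) ℝ) - Y = Vᵀ * (β • 1 - Ω) * V := by
      rw [Matrix.mul_sub, Matrix.sub_mul, ← hYdef, Matrix.mul_smul, Matrix.mul_one,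
        Matrix.smul_mul, hV']
    rw [h]
    simpa using hΩβ.conjTranspose_mul_mul_same V
  have hYpos : Y.PosDef := by
    have h := (Matrix.PosDef.one (n := Fin p) (R := ℝ)).smul hα |>.add_posSemidef hYα
    simpa using h
  have hdiagα : ∀ i, α ≤ Y i i := fun i => by simpa using hYα.diag_nonneg (i := i)
  have hdiagβ : ∀ i, Y i i ≤ β := fun i => by simpa using hYβ.diag_nonneg (i := i)
  have hlogstar : Real.log Ωstar.det = ∑ i, Real.log (lamT i) := by
    rw [hΩstar, Matrix.det_conj_of_mul_eq_one hV hV', Matrix.det_diagonal,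
      Real.log_prod fun i _ => (hα.trans_le (hα_le i)).ne']
  have hfrobstar : frobNorm (Ωstar - M) ^ 2 = ∑ i, (lamT i - lam i) ^ 2 := by
    rw [hΩstar, hM, ← Matrix.sub_mul, ← Matrix.mul_sub, frobNorm_sq_conj hV',
      Matrix.diagonal_sub, frobNorm_sq_diagonal]
  have hlog : Real.log Ω.det ≤ ∑ i, Real.log (Y i i) := by
    rw [hΩ, Matrix.det_conj_of_mul_eq_one hV hV']
    exact log_det_le_sum_log_diag hYpos
  have hfrob : ∑ i, (Y i i - lam i) ^ 2 ≤ frobNorm (Ω - M) ^ 2 := by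
    rw [hΩ, hM, ← Matrix.sub_mul, ← Matrix.mul_sub, frobNorm_sq_conj hV']
    simpa using sum_diag_sq_le_frobNorm_sq (Y - Matrix.diagonal lam)
  calc 1 / 2 * frobNorm (Ωstar - M) ^ 2 - (1 / ρ) * Real.log Ωstar.det
      = ∑ i, (1 / 2 * (lamT i - lam i) ^ 2 - (1 / ρ) * Real.log (lamT i)) := by
        rw [hlogstar, hfrobstar, Finset.sum_sub_distrib, Finset.mul_sum, Finset.mul_sum]
    _ ≤ ∑ i, (1 / 2 * (Y i i - lam i) ^ 2 - (1 / ρ) * Real.log (Y i i)) :=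
        Finset.sum_le_sum fun i _ =>
          clamp_minimizes_sq_sub_log hρ hα hαβ (hlamT i) (hdiagα i) (hdiagβ i)
    _ = 1 / 2 * ∑ i, (Y i i - lam i) ^ 2 - (1 / ρ) * ∑ i, Real.log (Y i i) := by
        rw [Finset.sum_sub_distrib, Finset.mul_sum, Finset.mul_sum]
    _ ≤ 1 / 2 * frobNorm (Ω - M) ^ 2 - (1 / ρ) * Real.log Ω.det := by
        have := one_div_pos.2 hρ
        gcongr
end
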